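/- Let k be a field, F a field extension of k such that F ⊗_k F is a noetherian ring of Krull dimension at most 1. Then F has transcendence degree at most 1 over k. -/

import Mathlib

open scoped TensorProduct

/-- An injective ring homomorphism from a domain to a field is flat. -/
theorem RingHom.Flat.of_injective_of_field {A F : Type*} [CommRing A] [IsDomain A] [Field F]
    (f : A →+* F) (hf : Function.Injective f) : f.Flat := by
  have hcomp : (IsFractionRing.lift (K := FractionRing A) hf).comp
      (algebraMap A (FractionRing A)) = f := by
    ext a
    simp
  have hloc : (algebraMap A (FractionRing A)).Flat :=
    RingHom.flat_algebraMap_iff.mpr (IsLocalization.flat _ (nonZeroDivisors A))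
  rw [← hcomp]
  exact hloc.comp (.of_isField (Field.toIsField _) _)

theorem not_ringKrullDim_le_one_of_lt_of_lt {R : Type*} [CommRing R] {p q r : Ideal R}
    [hp : p.IsPrime] [hq : q.IsPrime] [hr : r.IsPrime] (hpq : p < q) (hqr : q < r) :
    ¬ ringKrullDim R ≤ 1 := by
  intro h
  rcases Order.krullDim_le_one_iff.mp h ⟨q, hq⟩ with hmin | hmax
  · exact hmin.not_lt (b := ⟨p, hp⟩) hpq
  · exact hmax.not_lt (b := ⟨r, hr⟩) hqr

/-- Over a field, every ideal of `F[X₀, X₁]` of an `F`-rational point strictly contains a nonzero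
prime ideal. -/
theorem MvPolynomial.exists_isPrime_bot_lt_lt_ker_aeval {F : Type*} [Field F] (x y : F) :
    ∃ p : Ideal (MvPolynomial (Fin 2) F), p.IsPrime ∧ ⊥ < p ∧
      p < RingHom.ker (aeval ![x, y] : MvPolynomial (Fin 2) F →ₐ[F] F) := by
  let φ : MvPolynomial (Fin 2) F →ₐ[F] Polynomial F := aeval ![Polynomial.C x, Polynomial.X]
  have hφ : (Polynomial.aeval y).comp φ = aeval ![x, y] := by
    ext i
    fin_cases i <;> simp [φ]
  refine ⟨RingHom.ker φ, RingHom.ker_isPrime φ, ?_, ?_⟩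
  · refine bot_lt_iff_ne_bot.mpr fun h ↦ ?_
    have hmem : X 0 - C x ∈ RingHom.ker φ := by
      simp [φ, RingHom.mem_ker, ← Polynomial.algebraMap_eq]
    rw [h, Ideal.mem_bot] at hmem
    simpa using congrArg (aeval ![x + 1, y]) hmem
  · refine SetLike.lt_iff_le_and_exists.mpr ⟨fun a ha ↦ ?_, X 1 - C y, ?_, fun h ↦ ?_⟩
    · rw [RingHom.mem_ker] at ha ⊢
      rw [← hφ, AlgHom.comp_apply, ha, map_zero]
    · simp [RingHom.mem_ker]
    · rw [RingHom.mem_ker] at h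
      have h' := congrArg (Polynomial.eval (y + 1)) h
      simp [φ, ← Polynomial.algebraMap_eq] at h'

/-- If `F/k` is a field extension such that `F ⊗_k F` is a noetherian ring of
Krull dimension at most `1`, then `F` has transcendence degree at most `1` over
`k`, i.e. no two elements of `F` are algebraically independent over `k`. -/
theorem trdeg_le_one_of_tensor_noetherian_krullDim_le_one (k F : Type*)
    [Field k] [Field F] [Algebra k F]
    (hnoeth : IsNoetherianRing (F ⊗[k] F))
    (hdim : ringKrullDim (F ⊗[k] F) ≤ 1) :
    ∀ x y : F, ¬ AlgebraicIndependent k ![x, y] := by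
  intro x y hxy
  let ev : MvPolynomial (Fin 2) k →ₐ[k] F := MvPolynomial.aeval ![x, y]
  have hev : ev.Flat := RingHom.Flat.of_injective_of_field ev.toRingHom hxy
  let g : MvPolynomial (Fin 2) F →ₐ[F] F ⊗[k] F :=
    (Algebra.TensorProduct.lTensor (S := F) F ev).comp
      (MvPolynomial.algebraTensorAlgEquiv k F).symm.toAlgHom
  have hg : g.toRingHom.Flat :=
    (RingHom.Flat.of_bijective (MvPolynomial.algebraTensorAlgEquiv k F).symm.bijective).comp
      (RingHom.Flat.lTensor F hev)
  let μ : F ⊗[k] F →ₐ[F] F :=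
    Algebra.TensorProduct.lift (.id F F) (.id k F) fun _ _ ↦ .all _ _
  have hμg : μ.comp g = MvPolynomial.aeval ![x, y] := by
    ext i
    fin_cases i <;> simp [μ, g, ev]
  obtain ⟨p, hp, hbot, hlt⟩ := MvPolynomial.exists_isPrime_bot_lt_lt_ker_aeval x y
  algebraize [g.toRingHom]
  have hM : (RingHom.ker μ).IsPrime := RingHom.ker_isPrime μ
  have hMover : (RingHom.ker μ).LiesOver
      (RingHom.ker (MvPolynomial.aeval ![x, y] : MvPolynomial (Fin 2) F →ₐ[F] F)) :=
    ⟨by rw [← hμg]; rfl⟩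
  have hker := RingHom.ker_isPrime (MvPolynomial.aeval ![x, y] : MvPolynomial (Fin 2) F →ₐ[F] F)
  obtain ⟨Q, hQM, hQ, hQover⟩ := Ideal.exists_ideal_lt_liesOver_of_lt (RingHom.ker μ) hlt
  obtain ⟨P, hPQ, hP, -⟩ := Ideal.exists_ideal_lt_liesOver_of_lt Q hbot
  exact not_ringKrullDim_le_one_of_lt_of_lt hPQ hQM hdim
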